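/- Let p be an odd prime and let S = F_p[X]/(X³ − X), with v denoting the image of X in S. Then there exists a ring automorphism θ of S that is neither the identity map nor the map sending a + b·v + c·v² to a − b·v + c·v²; in particular, the claim of Mohammadi et al. that the only non-identity automorphism of S is a + b·v + c·v² ↦ a − b·v + c·v² is false. -/

import Mathlib

open Polynomial

/-- `S p` is the ring `F_p[X]/(X³ - X)`. -/
noncomputable abbrev S (p : ℕ) : Type := AdjoinRoot (X ^ 3 - X : (ZMod p)[X])

/-- `v p` is the image of `X` in `S p`. -/
noncomputable abbrev v (p : ℕ) : S p := AdjoinRoot.root _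

/-- The canonical embedding of `F_p` into `S p`. -/
noncomputable abbrev ofFp (p : ℕ) : ZMod p →+* S p := AdjoinRoot.of _

/-- The element `a + b·v + c·v²` of `S p`. -/
noncomputable def el (p : ℕ) (a b c : ZMod p) : S p :=
  ofFp p a + ofFp p b * v p + ofFp p c * (v p) ^ 2

/-- The element of `S p` taking the values `1, 0, -1` at `X = 0, 1, -1`. -/
noncomputable def swapRoot (p : ℕ) : S p :=
  1 + ofFp p 2⁻¹ * v p - 3 * ofFp p 2⁻¹ * v p ^ 2

theorem v_pow_three (p : ℕ) : v p ^ 3 = v p := by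
  have h := AdjoinRoot.eval₂_root (X ^ 3 - X : (ZMod p)[X])
  simpa [sub_eq_zero] using h

theorem two_mul_ofFp_inv_two (p : ℕ) [Fact p.Prime] (hodd : Odd p) :
    2 * ofFp p 2⁻¹ = 1 := by
  have h2 : (2 : ZMod p) ≠ 0 := by
    have h := (ZMod.isUnit_iff_coprime 2 p).2 (Nat.coprime_two_left.2 hodd)
    exact_mod_cast h.ne_zero
  have h := congrArg (ofFp p) (mul_inv_cancel₀ h2)
  simpa only [map_mul, map_ofNat, map_one] using h

theorem swapRoot_pow_three (p : ℕ) [Fact p.Prime] (hodd : Odd p) :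
    swapRoot p ^ 3 = swapRoot p := by
  have hv := v_pow_three p
  have ht := two_mul_ofFp_inv_two p hodd
  unfold swapRoot
  generalize v p = x at *
  generalize ofFp p 2⁻¹ = t at *
  grind

/-- The endomorphism of `S p` sending `v p` to `swapRoot p`. -/
noncomputable def swapHom (p : ℕ) [Fact p.Prime] (hodd : Odd p) : S p →+* S p :=
  AdjoinRoot.lift (ofFp p) (swapRoot p) (by simp [swapRoot_pow_three p hodd])

theorem swapHom_v (p : ℕ) [Fact p.Prime] (hodd : Odd p) :
    swapHom p hodd (v p) = swapRoot p :=
  AdjoinRoot.lift_root _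

theorem swapHom_ofFp (p : ℕ) [Fact p.Prime] (hodd : Odd p) (a : ZMod p) :
    swapHom p hodd (ofFp p a) = ofFp p a :=
  AdjoinRoot.lift_of _

theorem swapHom_swapRoot (p : ℕ) [Fact p.Prime] (hodd : Odd p) :
    swapHom p hodd (swapRoot p) = v p := by
  have hv := v_pow_three p
  have ht := two_mul_ofFp_inv_two p hodd
  have key : swapHom p hodd (swapRoot p) =
      1 + ofFp p 2⁻¹ * swapRoot p - 3 * ofFp p 2⁻¹ * swapRoot p ^ 2 := by
    conv_lhs => rw [swapRoot]
    simp only [map_add, map_sub, map_mul, map_pow, map_one, map_ofNat, swapHom_v, swapHom_ofFp]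
  rw [key]
  unfold swapRoot
  generalize v p = x at *
  generalize ofFp p 2⁻¹ = t at *
  grind

theorem swapHom_comp_self (p : ℕ) [Fact p.Prime] (hodd : Odd p) :
    (swapHom p hodd).comp (swapHom p hodd) = RingHom.id (S p) := by
  refine AdjoinRoot.ringHom_ext (RingHom.ext fun a => ?_) ?_
  · change swapHom p hodd (swapHom p hodd (ofFp p a)) = ofFp p a
    rw [swapHom_ofFp, swapHom_ofFp]
  · change swapHom p hodd (swapHom p hodd (v p)) = v p
    rw [swapHom_v, swapHom_swapRoot]

/-- Evaluation of elements of `S p` at `X = 0`. -/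
noncomputable def evalZero (p : ℕ) : S p →+* ZMod p :=
  AdjoinRoot.lift (RingHom.id _) 0 (by simp)

theorem evalZero_v (p : ℕ) : evalZero p (v p) = 0 :=
  AdjoinRoot.lift_root _

theorem evalZero_swapRoot (p : ℕ) : evalZero p (swapRoot p) = 1 := by
  simp only [swapRoot, map_add, map_sub, map_mul, map_pow, map_one, evalZero_v]
  simp

theorem exists_other_automorphism (p : ℕ) (hp : p.Prime) (hodd : Odd p) :
    ∃ θ : S p ≃+* S p,
      θ ≠ RingEquiv.refl (S p) ∧
      ¬ (∀ a b c : ZMod p, θ (el p a b c) = el p a (-b) c) := by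
  have : Fact p.Prime := ⟨hp⟩
  refine ⟨RingEquiv.ofRingHom (swapHom p hodd) (swapHom p hodd)
    (swapHom_comp_self p hodd) (swapHom_comp_self p hodd), fun h => ?_, fun h => ?_⟩
  · have h1 : swapHom p hodd (v p) = v p := DFunLike.congr_fun h (v p)
    have h2 := congrArg (evalZero p) h1
    rw [swapHom_v, evalZero_swapRoot, evalZero_v] at h2
    exact one_ne_zero h2
  · have h1 : swapHom p hodd (el p 0 1 0) = el p 0 (-1) 0 := h 0 1 0
    have h2 := congrArg (evalZero p) h1
    simp only [el, map_zero, map_one, map_neg, zero_mul, one_mul, zero_add, add_zero, neg_mul,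
      swapHom_v, evalZero_swapRoot, evalZero_v, neg_zero] at h2
    exact one_ne_zero h2
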